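/- arXiv:1610.09741 — 3 statements merged into one kernel-verified Lean document; each statement's English description precedes it below -/
import Mathlib

section
/- Let B = B₁ ⊔ B₂ with B₁ orthogonal to B₂, and B' = B₁' ⊔ B₂' with B₁' ⊆ B₁ and B₂' ⊆ B₂. Then the map (H₁, H₂) ↦ H₁ ∪ H₂ is a bijection from Ns(B₁,B₁') × Ns(B₂,B₂') onto Ns(B,B'), and it restricts to a bijection on maximal relative nested sets. -/
/-- Two subdiagrams of a diagram `G` are *orthogonal* if they are disjoint and no edge of
`G` joins a vertex of one to a vertex of the other. -/
def Diagram.Orthogonal {V : Type*} (G : SimpleGraph V) (B₁ B₂ : Finset V) : Prop :=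
  Disjoint B₁ B₂ ∧ ∀ i ∈ B₁, ∀ j ∈ B₂, ¬ G.Adj i j

/-- Two subdiagrams are *compatible* if one contains the other or they are orthogonal. -/
def Diagram.Compatible {V : Type*} (G : SimpleGraph V) (B₁ B₂ : Finset V) : Prop :=
  B₁ ⊆ B₂ ∨ B₂ ⊆ B₁ ∨ Diagram.Orthogonal G B₁ B₂

/-- A subdiagram is *connected* if the induced subgraph is connected. -/
def Diagram.IsConnSub {V : Type*} (G : SimpleGraph V) (C : Finset V) : Prop :=
  (G.induce (C : Set V)).Connected

/-- `C` is a connected component of the subdiagram `B`. -/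
def Diagram.IsCC {V : Type*} (G : SimpleGraph V) (B C : Finset V) : Prop :=
  C ⊆ B ∧ Diagram.IsConnSub G C ∧
    ∀ C' : Finset V, C ⊆ C' → C' ⊆ B → Diagram.IsConnSub G C' → C' = C

/-- A *nested set on `B` relative to `B'`* (an element of `Ns(B,B')`): a collection of
pairwise compatible connected subdiagrams of `B` which contains every connected component
of `B` and of `B'`, and each of whose elements is compatible with, and not properly
contained in, any connected component of `B'`. -/
def Diagram.IsRelNested {V : Type*} (G : SimpleGraph V) (B B' : Finset V)
    (H : Finset (Finset V)) : Prop :=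
  (∀ C ∈ H, C ⊆ B ∧ Diagram.IsConnSub G C) ∧
  (∀ C₁ ∈ H, ∀ C₂ ∈ H, Diagram.Compatible G C₁ C₂) ∧
  (∀ C : Finset V, Diagram.IsCC G B C → C ∈ H) ∧
  (∀ C : Finset V, Diagram.IsCC G B' C → C ∈ H) ∧
  (∀ C ∈ H, ∀ C' : Finset V, Diagram.IsCC G B' C' → Diagram.Compatible G C C' ∧ ¬ C ⊂ C')

/-- A *maximal* nested set on `B` relative to `B'`: one maximal with respect to inclusion
among relative nested sets. -/
def Diagram.IsMaxRelNested {V : Type*} (G : SimpleGraph V) (B B' : Finset V)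
    (H : Finset (Finset V)) : Prop :=
  Diagram.IsRelNested G B B' H ∧
    ∀ H' : Finset (Finset V), Diagram.IsRelNested G B B' H' → H ⊆ H' → H' = H

namespace Diagram

variable {V : Type*} {G : SimpleGraph V}

theorem Orthogonal.symm {B₁ B₂ : Finset V} (h : Orthogonal G B₁ B₂) : Orthogonal G B₂ B₁ :=
  ⟨h.1.symm, fun i hi j hj hij => h.2 j hj i hi hij.symm⟩

theorem Orthogonal.mono {B₁ B₂ C₁ C₂ : Finset V} (h : Orthogonal G B₁ B₂)
    (h1 : C₁ ⊆ B₁) (h2 : C₂ ⊆ B₂) : Orthogonal G C₁ C₂ :=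
  ⟨h.1.mono h1 h2, fun i hi j hj => h.2 i (h1 hi) j (h2 hj)⟩

theorem Orthogonal.compatible {B₁ B₂ : Finset V} (h : Orthogonal G B₁ B₂) :
    Compatible G B₁ B₂ :=
  Or.inr (Or.inr h)

theorem IsConnSub.nonempty {C : Finset V} (h : IsConnSub G C) : C.Nonempty := by
  obtain ⟨x, hx⟩ := SimpleGraph.Connected.nonempty h
  exact ⟨x, hx⟩

/-- A nonempty subdiagram is contained in at most one of two orthogonal subdiagrams. -/
theorem Orthogonal.not_subset {B₁ B₂ C : Finset V} (h : Orthogonal G B₁ B₂)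
    (hC : C.Nonempty) (h1 : C ⊆ B₁) : ¬ C ⊆ B₂ := by
  obtain ⟨x, hx⟩ := hC
  exact fun h2 => Finset.disjoint_left.1 h.1 (h1 hx) (h2 hx)

theorem IsCC.of_subset {B B' C : Finset V} (hC : IsCC G B C) (hB : B' ⊆ B) (h : C ⊆ B') :
    IsCC G B' C :=
  ⟨h, hC.2.1, fun C' hCC' hC' hconn => hC.2.2 C' hCC' (hC'.trans hB) hconn⟩

variable [DecidableEq V]

/-- A connected subdiagram of an orthogonal union lies in one of the two parts. -/
theorem IsConnSub.subset_or_subset {B₁ B₂ C : Finset V} (hC : IsConnSub G C)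
    (h : Orthogonal G B₁ B₂) (hsub : C ⊆ B₁ ∪ B₂) : C ⊆ B₁ ∨ C ⊆ B₂ := by
  by_contra! hne
  obtain ⟨⟨x, hx, hx1⟩, ⟨y, hy, hy2⟩⟩ := hne.imp Finset.not_subset.1 Finset.not_subset.1
  have hr := hC.preconnected ⟨y, hy⟩ ⟨x, hx⟩
  rw [SimpleGraph.reachable_iff_reflTransGen] at hr
  have key : ∀ z : (C : Set V),
      Relation.ReflTransGen (G.induce (C : Set V)).Adj ⟨y, hy⟩ z → (z : V) ∈ B₁ := by
    intro z hz
    induction hz with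
    | refl => exact (Finset.mem_union.1 (hsub hy)).resolve_right hy2
    | @tail b c _ hbc ih =>
      exact (Finset.mem_union.1 (hsub c.2)).resolve_right fun hc => h.2 _ ih _ hc hbc
  exact hx1 (key _ hr)

theorem IsCC.union_left {B₁ B₂ C : Finset V} (h : Orthogonal G B₁ B₂) (hC : IsCC G B₁ C) :
    IsCC G (B₁ ∪ B₂) C := by
  refine ⟨hC.1.trans Finset.subset_union_left, hC.2.1, fun C' hCC' hC' hconn => ?_⟩
  rcases hconn.subset_or_subset h hC' with h1 | h2
  · exact hC.2.2 C' hCC' h1 hconn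
  · exact absurd (hCC'.trans h2) (h.not_subset hC.2.1.nonempty hC.1)

/-- The connected components of an orthogonal union are those of its two parts. -/
theorem isCC_union_iff {B₁ B₂ C : Finset V} (h : Orthogonal G B₁ B₂) :
    IsCC G (B₁ ∪ B₂) C ↔ IsCC G B₁ C ∨ IsCC G B₂ C := by
  refine ⟨fun hC => ?_, ?_⟩
  · exact (hC.2.1.subset_or_subset h hC.1).imp (hC.of_subset Finset.subset_union_left)
      (hC.of_subset Finset.subset_union_right)
  · rintro (hC | hC)
    · exact hC.union_left h
    · exact Finset.union_comm B₁ B₂ ▸ hC.union_left h.symm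

variable {B₁ B₂ B₁' B₂' : Finset V} {H₁ H₂ K : Finset (Finset V)}

theorem IsRelNested.union (h : Orthogonal G B₁ B₂) (h1 : B₁' ⊆ B₁) (h2 : B₂' ⊆ B₂)
    (hH₁ : IsRelNested G B₁ B₁' H₁) (hH₂ : IsRelNested G B₂ B₂' H₂) :
    IsRelNested G (B₁ ∪ B₂) (B₁' ∪ B₂') (H₁ ∪ H₂) := by
  obtain ⟨a1, b1, c1, d1, e1⟩ := hH₁
  obtain ⟨a2, b2, c2, d2, e2⟩ := hH₂
  simp only [IsRelNested, isCC_union_iff h, isCC_union_iff (h.mono h1 h2), Finset.mem_union]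
  refine ⟨?_, ?_, fun C => Or.imp (c1 C) (c2 C), fun C => Or.imp (d1 C) (d2 C), ?_⟩
  · rintro C (hC | hC)
    · exact ⟨(a1 C hC).1.trans Finset.subset_union_left, (a1 C hC).2⟩
    · exact ⟨(a2 C hC).1.trans Finset.subset_union_right, (a2 C hC).2⟩
  · rintro C (hC | hC) C' (hC' | hC')
    · exact b1 C hC C' hC'
    · exact (h.mono (a1 C hC).1 (a2 C' hC').1).compatible
    · exact (h.symm.mono (a2 C hC).1 (a1 C' hC').1).compatible
    · exact b2 C hC C' hC'
  · rintro C (hC | hC) C' (hC' | hC')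
    · exact e1 C hC C' hC'
    · exact ⟨(h.mono (a1 C hC).1 (hC'.1.trans h2)).compatible, fun hlt =>
        h.not_subset (a1 C hC).2.nonempty (a1 C hC).1 (hlt.1.trans (hC'.1.trans h2))⟩
    · exact ⟨(h.symm.mono (a2 C hC).1 (hC'.1.trans h1)).compatible, fun hlt =>
        h.symm.not_subset (a2 C hC).2.nonempty (a2 C hC).1 (hlt.1.trans (hC'.1.trans h1))⟩
    · exact e2 C hC C' hC'

theorem IsRelNested.filter_left (h : Orthogonal G B₁ B₂) (h1 : B₁' ⊆ B₁) (h2 : B₂' ⊆ B₂)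
    (hK : IsRelNested G (B₁ ∪ B₂) (B₁' ∪ B₂') K) :
    IsRelNested G B₁ B₁' (K.filter (· ⊆ B₁)) := by
  obtain ⟨a, b, c, d, e⟩ := hK
  simp only [isCC_union_iff h, isCC_union_iff (h.mono h1 h2)] at c d e
  simp only [IsRelNested, Finset.mem_filter]
  exact ⟨fun C hC => ⟨hC.2, (a C hC.1).2⟩, fun C hC C' hC' => b C hC.1 C' hC'.1,
    fun C hC => ⟨c C (Or.inl hC), hC.1⟩, fun C hC => ⟨d C (Or.inl hC), hC.1.trans h1⟩,
    fun C hC C' hC' => e C hC.1 C' (Or.inl hC')⟩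

theorem IsRelNested.filter_right (h : Orthogonal G B₁ B₂) (h1 : B₁' ⊆ B₁) (h2 : B₂' ⊆ B₂)
    (hK : IsRelNested G (B₁ ∪ B₂) (B₁' ∪ B₂') K) :
    IsRelNested G B₂ B₂' (K.filter (· ⊆ B₂)) := by
  rw [Finset.union_comm B₁, Finset.union_comm B₁'] at hK
  exact hK.filter_left h.symm h2 h1

theorem IsRelNested.filter_union_filter (h : Orthogonal G B₁ B₂)
    (hK : IsRelNested G (B₁ ∪ B₂) (B₁' ∪ B₂') K) :
    K.filter (· ⊆ B₁) ∪ K.filter (· ⊆ B₂) = K := by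
  rw [← Finset.filter_or, Finset.filter_true_of_mem]
  exact fun C hC => (hK.1 C hC).2.subset_or_subset h (hK.1 C hC).1

theorem IsRelNested.filter_union_left (h : Orthogonal G B₁ B₂)
    (hH₁ : IsRelNested G B₁ B₁' H₁) (hH₂ : IsRelNested G B₂ B₂' H₂) :
    (H₁ ∪ H₂).filter (· ⊆ B₁) = H₁ := by
  rw [Finset.filter_union, Finset.filter_true_of_mem fun C hC => (hH₁.1 C hC).1,
    Finset.filter_false_of_mem fun C hC =>
      h.symm.not_subset (hH₂.1 C hC).2.nonempty (hH₂.1 C hC).1, Finset.union_empty]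

theorem IsRelNested.filter_union_right (h : Orthogonal G B₁ B₂)
    (hH₁ : IsRelNested G B₁ B₁' H₁) (hH₂ : IsRelNested G B₂ B₂' H₂) :
    (H₁ ∪ H₂).filter (· ⊆ B₂) = H₂ := by
  rw [Finset.union_comm]
  exact hH₂.filter_union_left h.symm hH₁

theorem IsMaxRelNested.union (h : Orthogonal G B₁ B₂) (h1 : B₁' ⊆ B₁) (h2 : B₂' ⊆ B₂)
    (hH₁ : IsMaxRelNested G B₁ B₁' H₁) (hH₂ : IsMaxRelNested G B₂ B₂' H₂) :
    IsMaxRelNested G (B₁ ∪ B₂) (B₁' ∪ B₂') (H₁ ∪ H₂) := by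
  refine ⟨hH₁.1.union h h1 h2 hH₂.1, fun K hK hle => ?_⟩
  have e1 := hH₁.2 _ (hK.filter_left h h1 h2) (by
    rw [← hH₁.1.filter_union_left h hH₂.1]; exact Finset.filter_subset_filter _ hle)
  have e2 := hH₂.2 _ (hK.filter_right h h1 h2) (by
    rw [← hH₁.1.filter_union_right h hH₂.1]; exact Finset.filter_subset_filter _ hle)
  rw [← hK.filter_union_filter h, e1, e2]

theorem IsMaxRelNested.filter_left (h : Orthogonal G B₁ B₂) (h1 : B₁' ⊆ B₁) (h2 : B₂' ⊆ B₂)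
    (hK : IsMaxRelNested G (B₁ ∪ B₂) (B₁' ∪ B₂') K) :
    IsMaxRelNested G B₁ B₁' (K.filter (· ⊆ B₁)) := by
  refine ⟨hK.1.filter_left h h1 h2, fun H hH hle => ?_⟩
  have hr := hK.1.filter_right h h1 h2
  have e := hK.2 _ (hH.union h h1 h2 hr) (by
    conv_lhs => rw [← hK.1.filter_union_filter h]
    exact Finset.union_subset_union_left hle)
  rw [← hH.filter_union_left h hr, e]

theorem IsMaxRelNested.filter_right (h : Orthogonal G B₁ B₂) (h1 : B₁' ⊆ B₁)
    (h2 : B₂' ⊆ B₂) (hK : IsMaxRelNested G (B₁ ∪ B₂) (B₁' ∪ B₂') K) :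
    IsMaxRelNested G B₂ B₂' (K.filter (· ⊆ B₂)) := by
  rw [Finset.union_comm B₁, Finset.union_comm B₁'] at hK
  exact hK.filter_left h.symm h2 h1

end Diagram

/-- **Orthogonal union of relative nested sets.**  Let `B = B₁ ⊔ B₂` with `B₁` orthogonal
to `B₂`, and `B' = B₁' ⊔ B₂'` with `B₁' ⊆ B₁` and `B₂' ⊆ B₂`.  Then `(H₁, H₂) ↦ H₁ ∪ H₂`
is a bijection from `Ns(B₁,B₁') × Ns(B₂,B₂')` onto `Ns(B,B')`, and it restricts to a
bijection on maximal relative nested sets. -/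
theorem relNested_orthogonal_union {V : Type*} [DecidableEq V] (G : SimpleGraph V)
    (B₁ B₂ B₁' B₂' : Finset V) (horth : Diagram.Orthogonal G B₁ B₂)
    (h1 : B₁' ⊆ B₁) (h2 : B₂' ⊆ B₂) :
    Set.BijOn (fun p : Finset (Finset V) × Finset (Finset V) => p.1 ∪ p.2)
      {p | Diagram.IsRelNested G B₁ B₁' p.1 ∧ Diagram.IsRelNested G B₂ B₂' p.2}
      {K | Diagram.IsRelNested G (B₁ ∪ B₂) (B₁' ∪ B₂') K} ∧
    Set.BijOn (fun p : Finset (Finset V) × Finset (Finset V) => p.1 ∪ p.2)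
      {p | Diagram.IsMaxRelNested G B₁ B₁' p.1 ∧ Diagram.IsMaxRelNested G B₂ B₂' p.2}
      {K | Diagram.IsMaxRelNested G (B₁ ∪ B₂) (B₁' ∪ B₂') K} := by
  have hinj : Set.InjOn (fun p : Finset (Finset V) × Finset (Finset V) => p.1 ∪ p.2)
      {p | Diagram.IsRelNested G B₁ B₁' p.1 ∧ Diagram.IsRelNested G B₂ B₂' p.2} := by
    rintro p ⟨hp1, hp2⟩ q ⟨hq1, hq2⟩ (hpq : p.1 ∪ p.2 = q.1 ∪ q.2)
    refine Prod.ext ?_ ?_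
    · rw [← hp1.filter_union_left horth hp2, hpq, hq1.filter_union_left horth hq2]
    · rw [← hp1.filter_union_right horth hp2, hpq, hq1.filter_union_right horth hq2]
  exact ⟨⟨fun p hp => hp.1.union horth h1 h2 hp.2, hinj, fun K hK =>
      ⟨(K.filter (· ⊆ B₁), K.filter (· ⊆ B₂)),
        ⟨hK.filter_left horth h1 h2, hK.filter_right horth h1 h2⟩,
        hK.filter_union_filter horth⟩⟩,
    ⟨fun p hp => hp.1.union horth h1 h2 hp.2,
      hinj.mono fun _ hp => And.intro hp.1.1 hp.2.1, fun K hK =>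
      ⟨(K.filter (· ⊆ B₁), K.filter (· ⊆ B₂)),
        ⟨hK.filter_left horth h1 h2, hK.filter_right horth h1 h2⟩,
        hK.1.filter_union_filter horth⟩⟩⟩
end

section
/- For any realisation (V, Π, Π∨) of A there exist a subspace U ⊆ V containing Π∨, such that the restrictions of the α_i to U are linearly independent and dim U = 2|I| − rank(A) (so that (U, Π|_U, Π∨) is a minimal realisation of A), and a subspace U⁰ ⊆ Π⊥ such that V = U ⊕ U⁰. -/
/-- A *realisation* of the matrix `A` : the data of a finite-dimensional `k`-vector space
`V`, a linearly independent family `α = {α_i} ⊆ V*`, and a linearly independent family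
`hv = {h_i^∨} ⊆ V` such that `α_i (h_j^∨) = a_{ji}` for all `i, j`. -/
structure IsRealisation {k : Type*} [Field k] {I : Type*} [Fintype I]
    (A : Matrix I I k) (V : Type*) [AddCommGroup V] [Module k V]
    (α : I → (V →ₗ[k] k)) (hv : I → V) : Prop where
  finite : FiniteDimensional k V
  indep_alpha : LinearIndependent k α
  indep_h : LinearIndependent k hv
  pairing : ∀ i j, α i (hv j) = A j i

open Module in
/-- The common kernel of a linearly independent family of linear forms has codimension
equal to the cardinality of the family. -/
theorem card_add_finrank_iInf_ker {k V I : Type*} [Field k] [AddCommGroup V] [Module k V]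
    [FiniteDimensional k V] [Fintype I] {f : I → V →ₗ[k] k} (hf : LinearIndependent k f) :
    Fintype.card I + finrank k (⨅ i, LinearMap.ker (f i) : Submodule k V) = finrank k V := by
  have hker : (⨅ i, LinearMap.ker (f i)) =
      (Submodule.span k (Set.range f)).dualCoannihilator := by
    refine SetLike.coe_injective ?_
    rw [Submodule.coe_dualCoannihilator_span]
    ext x
    simp
  rw [hker, ← finrank_span_eq_card hf]
  exact Subspace.finrank_add_finrank_dualCoannihilator_eq _

open Module in
/-- In a realisation of `A`, the subspace `V' ∩ Π⊥` has dimension `|I| - rank A`. -/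
theorem IsRealisation.rank_add_finrank_inf {k V I : Type*} [Field k] [AddCommGroup V]
    [Module k V] [Fintype I] {A : Matrix I I k} {α : I → V →ₗ[k] k} {hv : I → V}
    (h : IsRealisation A V α hv) :
    A.rank + finrank k ((⨅ i, LinearMap.ker (α i)) ⊓ Submodule.span k (Set.range hv) :
      Submodule k V) = Fintype.card I := by
  let l := Fintype.linearCombination k hv
  have hl : Function.Injective l := h.indep_h.fintypeLinearCombination_injective
  have hker : ((⨅ i, LinearMap.ker (α i)) ⊓ Submodule.span k (Set.range hv)) =
      (LinearMap.ker A.transpose.mulVecLin).map l := by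
    ext x
    simp only [← Fintype.range_linearCombination, Submodule.mem_inf, Submodule.mem_iInf,
      LinearMap.mem_ker, LinearMap.mem_range, Submodule.mem_map]
    have key (c : I → k) : A.transpose.mulVecLin c = fun i => α i (l c) := by
      ext i
      simp [l, Fintype.linearCombination_apply, h.pairing, Matrix.vecMul, dotProduct]
    constructor
    · rintro ⟨hx, c, rfl⟩
      exact ⟨c, (key c).trans (funext hx), rfl⟩
    · rintro ⟨c, hc, rfl⟩
      exact ⟨fun i => congrFun ((key c).symm.trans hc) i, c, rfl⟩
  rw [hker, ← (Submodule.equivMapOfInjective l hl _).finrank_eq, ← Matrix.rank_transpose A,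
    Matrix.rank, LinearMap.finrank_range_add_finrank_ker, finrank_fintype_fun_eq_card]

/-- For any realisation `(V, Π, Π∨)` of `A` there exist a subspace `U ⊆ V` containing
`Π∨`, such that the restrictions of the `α_i` to `U` are linearly independent and
`dim U = 2|I| − rank(A)` (so that `(U, Π|_U, Π∨)` is a minimal realisation of `A`), and a
subspace `U⁰ ⊆ Π⊥` such that `V = U ⊕ U⁰`. -/
theorem exists_minimal_subrealisation {k : Type*} [Field k] [CharZero k] {I : Type*}
    [Fintype I] (A : Matrix I I k) (V : Type*) [AddCommGroup V] [Module k V]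
    (α : I → (V →ₗ[k] k)) (hv : I → V) (hreal : IsRealisation A V α hv) :
    ∃ U U0 : Submodule k V,
      (∀ i, hv i ∈ U) ∧
      LinearIndependent k (fun i => (α i).domRestrict U) ∧
      Module.finrank k U = 2 * Fintype.card I - A.rank ∧
      U0 ≤ (⨅ i, LinearMap.ker (α i)) ∧
      IsCompl U U0 := by
  have := hreal.finite
  have hP := card_add_finrank_iInf_ker hreal.indep_alpha
  have hW := hreal.rank_add_finrank_inf
  set P := ⨅ i, LinearMap.ker (α i)
  set V' := Submodule.span k (Set.range hv)
  obtain ⟨U0, hdisj, hsup⟩ :=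
    IsModularLattice.exists_disjoint_and_sup_eq (inf_le_left : P ⊓ V' ≤ P)
  have hU0 : U0 ≤ P := hsup ▸ le_sup_right
  have hV' : Disjoint V' U0 := by
    rw [disjoint_iff_inf_le]
    exact fun x hx => hdisj.le_bot ⟨⟨hU0 hx.2, hx.1⟩, hx.2⟩
  obtain ⟨U, hU, hcompl⟩ := hV'.exists_isCompl
  refine ⟨U, U0, fun i => hU (Submodule.subset_span ⟨i, rfl⟩), ?_, ?_, hU0, hcompl⟩
  · rw [Fintype.linearIndependent_iff]
    intro g hg
    refine Fintype.linearIndependent_iff.mp hreal.indep_alpha g (LinearMap.ext fun x => ?_)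
    obtain ⟨u, hu, w, hw, rfl⟩ := Submodule.mem_sup.mp
      (hcompl.sup_eq_top ▸ Submodule.mem_top : x ∈ U ⊔ U0)
    have hgu : ∑ i, g i * α i u = 0 := by simpa using LinearMap.congr_fun hg ⟨u, hu⟩
    have hαw (i) : α i w = 0 := (Submodule.mem_iInf _).mp (hU0 hw) i
    simpa [hαw] using hgu
  · have h1 := Submodule.finrank_add_eq_of_isCompl hcompl
    have h2 := Submodule.finrank_sup_add_finrank_inf_eq (P ⊓ V') U0
    rw [hsup, hdisj.eq_bot, finrank_bot] at h2
    omega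
end

section
/- Let T ∈ Hom_A(V₁, V₂) be a morphism of realisations of A. If V₂ is of minimal dimension 2|I| − rank(A), then T is surjective. -/
/-- A *morphism of realisations* `T : (V₁, Π₁, Π₁∨) → (V₂, Π₂, Π₂∨)`: a `k`-linear map
with `T (h_{1,i}^∨) = h_{2,i}^∨` and `α_{2,i} ∘ T = α_{1,i}` for all `i`. -/
def IsRealisationHom {k : Type*} [Field k] {I : Type*}
    {V₁ : Type*} [AddCommGroup V₁] [Module k V₁]
    {V₂ : Type*} [AddCommGroup V₂] [Module k V₂]
    (α₁ : I → (V₁ →ₗ[k] k)) (hv₁ : I → V₁)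
    (α₂ : I → (V₂ →ₗ[k] k)) (hv₂ : I → V₂) (T : V₁ →ₗ[k] V₂) : Prop :=
  (∀ i, T (hv₁ i) = hv₂ i) ∧ ∀ i, (α₂ i).comp T = α₁ i

/-- A finite linearly independent family of functionals is jointly surjective. -/
theorem LinearIndependent.surjective_linearMap_pi {k : Type*} [Field k] {I : Type*} [Fintype I]
    {V : Type*} [AddCommGroup V] [Module k V] {α : I → (V →ₗ[k] k)}
    (hα : LinearIndependent k α) : Function.Surjective (LinearMap.pi α) := by
  classical
  rw [← LinearMap.dualMap_injective_iff, injective_iff_map_eq_zero]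
  intro φ hφ
  have hsum : ∑ i, φ (Pi.single i 1) • α i = 0 := by
    ext v
    have hv := LinearMap.congr_fun hφ v
    rw [LinearMap.dualMap_apply, LinearMap.pi_apply_eq_sum_univ φ] at hv
    have hsingle (i : I) : (fun j => if i = j then (1 : k) else 0) = Pi.single i 1 := by
      ext j
      simp [Pi.single_apply, eq_comm]
    simpa [hsingle, mul_comm] using hv
  have hzero := Fintype.linearIndependent_iff.1 hα _ hsum
  refine LinearMap.pi_ext' fun i => LinearMap.ext_ring ?_
  simpa using hzero i

theorem IsRealisation.ker_pi_le_span {k : Type*} [Field k] {I : Type*} [Fintype I]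
    {A : Matrix I I k} {V : Type*} [AddCommGroup V] [Module k V]
    {α : I → (V →ₗ[k] k)} {hv : I → V} (h : IsRealisation A V α hv)
    (hmin : Module.finrank k V = 2 * Fintype.card I - A.rank) :
    LinearMap.ker (LinearMap.pi α) ≤ Submodule.span k (Set.range hv) := by
  classical
  have := h.finite
  set P := LinearMap.pi α
  set S := Fintype.linearCombination k hv
  have hPS : P ∘ₗ S = A.transpose.mulVecLin := by
    ext c i
    simp [P, S, Fintype.linearCombination_apply, h.pairing,
      Pi.single_apply]
  have hS : Function.Injective S :=
    linearIndependent_iff_injective_fintypeLinearCombination.1 h.indep_h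
  have hle : (LinearMap.ker (P ∘ₗ S)).map S ≤ LinearMap.ker P := by
    rintro _ ⟨c, hc, rfl⟩
    exact hc
  have hkerPS : A.rank + Module.finrank k (LinearMap.ker (P ∘ₗ S)) = Fintype.card I := by
    have hr := (P ∘ₗ S).finrank_range_add_finrank_ker
    rw [Module.finrank_fintype_fun_eq_card] at hr
    rw [← hr, ← A.rank_transpose, Matrix.rank, hPS]
  have hkerP : Fintype.card I + Module.finrank k (LinearMap.ker P) = Module.finrank k V := by
    have hr := P.finrank_range_add_finrank_ker
    rwa [LinearMap.range_eq_top.2 h.indep_alpha.surjective_linearMap_pi, finrank_top,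
      Module.finrank_fintype_fun_eq_card] at hr
  have hmap : Module.finrank k ((LinearMap.ker (P ∘ₗ S)).map S) =
      Module.finrank k (LinearMap.ker (P ∘ₗ S)) :=
    (Submodule.equivMapOfInjective S hS _).finrank_eq.symm
  rw [← Submodule.eq_of_le_of_finrank_eq hle (by omega), ← Fintype.range_linearCombination k hv]
  exact LinearMap.map_le_range

/-- Let `T ∈ Hom_A(V₁, V₂)` be a morphism of realisations of `A`.  If `V₂` is of minimal
dimension `2|I| − rank(A)`, then `T` is surjective. -/
theorem realisationHom_surjective {k : Type*} [Field k] [CharZero k] {I : Type*} [Fintype I]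
    (A : Matrix I I k)
    (V₁ : Type*) [AddCommGroup V₁] [Module k V₁]
    (V₂ : Type*) [AddCommGroup V₂] [Module k V₂]
    (α₁ : I → (V₁ →ₗ[k] k)) (hv₁ : I → V₁) (α₂ : I → (V₂ →ₗ[k] k)) (hv₂ : I → V₂)
    (h₁ : IsRealisation A V₁ α₁ hv₁) (h₂ : IsRealisation A V₂ α₂ hv₂)
    (hmin : Module.finrank k V₂ = 2 * Fintype.card I - A.rank)
    (T : V₁ →ₗ[k] V₂) (hT : IsRealisationHom α₁ hv₁ α₂ hv₂ T) :
    Function.Surjective T := by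
  have hP : LinearMap.pi α₂ ∘ₗ T = LinearMap.pi α₁ := by
    ext v i
    exact LinearMap.congr_fun (hT.2 i) v
  have hker : LinearMap.ker (LinearMap.pi α₂) ≤ LinearMap.range T := by
    refine (h₂.ker_pi_le_span hmin).trans (Submodule.span_le.2 ?_)
    rintro _ ⟨i, rfl⟩
    exact ⟨hv₁ i, hT.1 i⟩
  intro w
  obtain ⟨v, hv⟩ := h₁.indep_alpha.surjective_linearMap_pi (LinearMap.pi α₂ w)
  obtain ⟨u, hu⟩ := hker (x := w - T v) (by
    rw [LinearMap.mem_ker, map_sub, sub_eq_zero, ← hv, ← hP, LinearMap.comp_apply])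
  exact ⟨u + v, by rw [map_add, hu, sub_add_cancel]⟩
end
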